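/- arXiv:1208.4329 — 2 statements merged into one kernel-verified Lean document; each statement's English description precedes it below -/
import Mathlib

section
/- Let E be the elliptic curve over ℚ given by Y² = X³ + X + 1, and for a nonzero squarefree integer n let Eₙ denote its quadratic twist by n, given by the Weierstrass model Y² = X³ + n²X + n³ over ℚ. Then Eₙ(ℚ) has trivial torsion subgroup: every point P in the group Eₙ(ℚ) of rational points satisfying k·P = O for some integer k ≥ 1 is the point at infinity O. -/
open WeierstrassCurve

/-- `x` is a quotient of odd integers divided by `2 ^ m`. -/
def TwL (m : ℕ) (x : ℚ) : Prop :=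
  ∃ a b : ℤ, Odd a ∧ Odd b ∧ x = (a : ℚ) / (2 ^ m * b)

/-- `x` is 2-adically in `2 ℤ_2`. -/
def TwE (x : ℚ) : Prop := ∃ c b : ℤ, Odd b ∧ x = (2 * c : ℚ) / b

/-- `x`-coordinate duplication. -/
def twD (x : ℚ) : ℚ := (x ^ 4 - 2 * x ^ 2 - 8 * x + 1) / (4 * (x ^ 3 + x + 1))

lemma tw_odd_ne {b : ℤ} (hb : Odd b) : (b : ℚ) ≠ 0 := by
  have : b ≠ 0 := by rintro rfl; simp at hb
  exact_mod_cast this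

lemma tw_cases (x : ℚ) : TwE x ∨ ∃ m, TwL m x := by
  have hx : x = (x.num : ℚ) / (x.den : ℚ) := (Rat.num_div_den x).symm
  rcases Int.even_or_odd x.num with h | h
  · left
    obtain ⟨c, hc⟩ := h
    refine ⟨c, x.den, ?_, ?_⟩
    · have hcop := x.reduced
      by_contra hd
      have hd' : Even x.den := by
        rw [← Nat.not_odd_iff_even]; exact_mod_cast hd
      have h2 : 2 ∣ x.num.natAbs := by omega
      have := Nat.dvd_gcd h2 hd'.two_dvd
      rw [hcop] at this
      omega
    · rw [hc] at hx
      push_cast at hx ⊢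
      rw [two_mul]; exact hx
  · right
    obtain ⟨m, k, hk, hd⟩ := Nat.exists_eq_two_pow_mul_odd (n := x.den) x.den_ne_zero
    refine ⟨m, x.num, k, h, by exact_mod_cast hk, ?_⟩
    rw [hd] at hx
    push_cast at hx ⊢
    exact hx

lemma tw_uniq_aux {m k : ℕ} {x : ℚ} (h : TwL m x) (h' : TwL (m + k + 1) x) : False := by
  obtain ⟨a, b, ha, hb, h⟩ := h
  obtain ⟨c, d, hc, hd, h'⟩ := h'
  have hb0 := tw_odd_ne hb
  have hd0 := tw_odd_ne hd
  rw [h, div_eq_div_iff (by positivity) (by positivity)] at h'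
  have e : (a : ℚ) * (2 * (2 ^ k * d)) = c * b := by
    have h2 : (2 : ℚ) ^ m ≠ 0 := by positivity
    apply mul_left_cancel₀ h2
    rw [pow_succ, pow_add] at h'
    linear_combination h'
  have e' : a * (2 * (2 ^ k * d)) = c * b := by exact_mod_cast e
  have ho := hc.mul hb
  rw [← e'] at ho
  have : Even (a * (2 * (2 ^ k * d))) := (even_two_mul _).mul_left _
  exact (Int.not_even_iff_odd.2 ho) this

lemma tw_uniq {m k : ℕ} {x : ℚ} (h : TwL m x) (h' : TwL k x) : m = k := by
  rcases lt_trichotomy m k with hl | hl | hl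
  · obtain ⟨j, rfl⟩ := Nat.exists_eq_add_of_lt hl
    exact (tw_uniq_aux h h').elim
  · exact hl
  · obtain ⟨j, rfl⟩ := Nat.exists_eq_add_of_lt hl
    exact (tw_uniq_aux h' h).elim

lemma tw_E {x : ℚ} (h : TwE x) : x ^ 3 + x + 1 ≠ 0 ∧ TwL 2 (twD x) := by
  obtain ⟨c, b, hb, rfl⟩ := h
  have hb0 := tw_odd_ne hb
  have hf : Odd ((2 * c) ^ 3 + (2 * c) * b ^ 2 + b ^ 3) := by
    simp [Int.odd_add, parity_simps, Int.not_even_iff_odd.2 hb]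
  have hf0 := tw_odd_ne hf
  push_cast at hf0
  have e : (2 * c / b : ℚ) ^ 3 + 2 * c / b + 1
      = ((2 * c) ^ 3 + (2 * c) * b ^ 2 + b ^ 3) / b ^ 3 := by
    field_simp
  refine ⟨by rw [e]; positivity, (2 * c) ^ 4 - 2 * (2 * c) ^ 2 * b ^ 2 - 8 * (2 * c) * b ^ 3 + b ^ 4,
    b * ((2 * c) ^ 3 + (2 * c) * b ^ 2 + b ^ 3), ?_, hb.mul hf, ?_⟩
  · simp [parity_simps, Int.not_even_iff_odd.2 hb]
  · rw [twD, e]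
    push_cast
    field_simp
    ring

lemma tw_L {m : ℕ} {x : ℚ} (h : TwL (m + 1) x) :
    x ^ 3 + x + 1 ≠ 0 ∧ TwL (m + 1 + 2) (twD x) := by
  obtain ⟨a, b, ha, hb, h⟩ := h
  have hb0 := tw_odd_ne hb
  obtain ⟨t, ht⟩ : ∃ t : ℤ, t = 2 ^ m * b := ⟨_, rfl⟩
  have htq : (t : ℚ) = 2 ^ m * b := by rw [ht]; push_cast; ring
  have ht0 : (t : ℚ) ≠ 0 := by rw [htq]; positivity
  have hx : x = a / (2 * t) := by rw [h, htq]; congr 1; ring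
  have hf : Odd (a ^ 3 + a * (2 * t) ^ 2 + (2 * t) ^ 3) := by
    simp [parity_simps, ha]
  have hf0 := tw_odd_ne hf
  push_cast at hf0
  have e : x ^ 3 + x + 1
      = (a ^ 3 + a * (2 * t) ^ 2 + (2 * t) ^ 3) / (2 * t) ^ 3 := by
    rw [hx]; field_simp
  refine ⟨by rw [e]; positivity, a ^ 4 - 2 * a ^ 2 * (2 * t) ^ 2 - 8 * a * (2 * t) ^ 3 + (2 * t) ^ 4,
    b * (a ^ 3 + a * (2 * t) ^ 2 + (2 * t) ^ 3), ?_, hb.mul hf, ?_⟩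
  · simp [parity_simps, ha]
  · have e2 : (2 : ℚ) ^ (m + 1 + 2) * ((b * (a ^ 3 + a * (2 * t) ^ 2 + (2 * t) ^ 3) : ℤ) : ℚ)
        = 8 * t * (a ^ 3 + a * (2 * t) ^ 2 + (2 * t) ^ 3) := by
      push_cast
      rw [htq]; ring
    rw [twD, e, e2, hx]
    push_cast
    field_simp
    ring

lemma tw_L0 {x : ℚ} (h : TwL 0 x) : x ^ 3 + x + 1 ≠ 0 ∧ TwE (twD x) := by
  obtain ⟨a, b, ha, hb, h⟩ := h
  have hb0 := tw_odd_ne hb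
  have hx : x = a / b := by rw [h]; simp
  have hf : Odd (a ^ 3 + a * b ^ 2 + b ^ 3) := by
    simp [parity_simps, Int.not_even_iff_odd.2 ha, Int.not_even_iff_odd.2 hb]
  have hf0 := tw_odd_ne hf
  push_cast at hf0
  have e : x ^ 3 + x + 1 = (a ^ 3 + a * b ^ 2 + b ^ 3) / b ^ 3 := by
    rw [hx]; field_simp
  obtain ⟨s, hs⟩ := ha
  obtain ⟨r, hr⟩ := hb
  have hsr : (a ^ 2 - b ^ 2) ^ 2 = 8 * (2 * (s * (s + 1) - r * (r + 1)) ^ 2) := by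
    subst hs hr; ring
  have hsrq : ((a : ℚ) ^ 2 - b ^ 2) ^ 2 = 8 * (2 * (s * (s + 1) - r * (r + 1)) ^ 2) := by
    exact_mod_cast hsr
  refine ⟨by rw [e]; positivity, 2 * (s * (s + 1) - r * (r + 1)) ^ 2 - a * b ^ 3,
    b * (a ^ 3 + a * b ^ 2 + b ^ 3), Odd.mul ⟨r, hr⟩ hf, ?_⟩
  rw [twD, e, hx]
  push_cast
  rw [div_eq_div_iff (by positivity) (by positivity)]
  field_simp
  linear_combination ((a : ℚ) ^ 3 + a * b ^ 2 + b ^ 3) * hsrq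

lemma tw_step (x : ℚ) : x ^ 3 + x + 1 ≠ 0 := by
  rcases tw_cases x with h | ⟨m, h⟩
  · exact (tw_E h).1
  · cases m with
    | zero => exact (tw_L0 h).1
    | succ m => exact (tw_L h).1

lemma tw_double (n : ℤ) (hn0 : n ≠ 0)
    (P : WeierstrassCurve.Affine.Point
      (⟨0, 0, 0, (n : ℚ) ^ 2, (n : ℚ) ^ 3⟩ : WeierstrassCurve.Affine ℚ))
    (X Y : ℚ) (h) (hP : P = .some X Y h) :
    ∃ X' Y' h', (2 • P = .some X' Y' h') ∧ X' / n = twD (X / n) := by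
  have hn : (n : ℚ) ≠ 0 := by exact_mod_cast hn0
  have heq : Y ^ 2 = X ^ 3 + n ^ 2 * X + n ^ 3 := by
    have := (Affine.equation_iff _ _).1 h.1
    simpa using this
  have hf := tw_step (X / n)
  have hY2 : Y ^ 2 = n ^ 3 * ((X / n) ^ 3 + X / n + 1) := by
    rw [heq]; field_simp
  have hY : Y ≠ 0 := by
    rintro rfl
    have : (n : ℚ) ^ 3 * ((X / n) ^ 3 + X / n + 1) ≠ 0 := by positivity
    exact this (by rw [← hY2]; norm_num)
  have hneg : Y ≠ Affine.negY
      (⟨0, 0, 0, (n : ℚ) ^ 2, (n : ℚ) ^ 3⟩ : WeierstrassCurve.Affine ℚ) X Y := by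
    simp only [Affine.negY]
    intro hh
    apply hY
    linarith
  refine ⟨_, _, _, by rw [two_nsmul, hP, Affine.Point.add_self_of_Y_ne hneg], ?_⟩
  rw [Affine.slope_of_Y_ne rfl hneg]
  simp only [Affine.addX, Affine.negY]
  obtain ⟨x, hx⟩ : ∃ x, x = X / n := ⟨_, rfl⟩
  have hX : X = n * x := by rw [hx]; field_simp
  rw [← hx] at hf hY2 ⊢
  have e : (3 * X ^ 2 + 2 * 0 * X + n ^ 2 - 0 * Y) / (Y - (-Y - 0 * X - 0))
      = (3 * X ^ 2 + n ^ 2) / (2 * Y) := by congr 1 <;> ring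
  rw [e, div_pow, mul_pow, hY2, twD, hX]
  generalize hF : x ^ 3 + x + 1 = F at hf
  field_simp
  rw [← hF]
  ring

lemma tw_abs1 {A : Type*} [AddCommGroup A] (P : A) (i : ℕ) :
    2 ^ (i + 1) • P = 2 • 2 ^ i • P := by
  rw [smul_smul, pow_succ']

lemma tw_abs2 {A : Type*} [AddCommGroup A] (P : A) (k : ℕ) (hkP : k • P = 0) (j : ℕ) :
    (j % k) • P = j • P := by
  conv_rhs => rw [← Nat.mod_add_div j k, add_smul, mul_comm, mul_smul, hkP, smul_zero, add_zero]

lemma tw_abs3 {A : Type*} [AddCommGroup A] (P : A) (k : ℕ) (hkP : k • P = 0) :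
    k • (2 • P) = 0 := by
  rw [smul_comm, hkP, smul_zero]

lemma tw_iter (n : ℤ) (hn0 : n ≠ 0) (m : ℕ)
    (P : WeierstrassCurve.Affine.Point
      (⟨0, 0, 0, (n : ℚ) ^ 2, (n : ℚ) ^ 3⟩ : WeierstrassCurve.Affine ℚ))
    (X Y : ℚ) (h) (hP : P = .some X Y h) (hL : TwL (m + 1) (X / n)) (i : ℕ) :
    ∃ X' Y' h', (2 ^ i • P = .some X' Y' h') ∧ TwL (m + 2 * i + 1) (X' / n) := by
  induction i with
  | zero => exact ⟨X, Y, h, by simpa using hP, by simpa using hL⟩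
  | succ i ih =>
    obtain ⟨X', Y', h', e, hL'⟩ := ih
    obtain ⟨X2, Y2, h2, e2, hd⟩ := tw_double n hn0 _ X' Y' h' e
    refine ⟨X2, Y2, h2, ?_, ?_⟩
    · rw [← e2]; exact tw_abs1 P i
    · rw [hd]
      exact (tw_L hL').2

lemma tw_no (n : ℤ) (hn0 : n ≠ 0) (m : ℕ)
    (P : WeierstrassCurve.Affine.Point
      (⟨0, 0, 0, (n : ℚ) ^ 2, (n : ℚ) ^ 3⟩ : WeierstrassCurve.Affine ℚ))
    (X Y : ℚ) (h) (hP : P = .some X Y h) (hL : TwL (m + 1) (X / n))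
    (k : ℕ) (hk : 1 ≤ k) (hkP : k • P = 0) : False := by
  have key : ∀ j : ℕ, (j % k) • P = j • P := by
    exact fun j => tw_abs2 P k hkP j
  obtain ⟨i, j, hij, he⟩ := Finite.exists_ne_map_eq_of_infinite
    (fun i : ℕ => (⟨2 ^ i % k, Nat.mod_lt _ hk⟩ : Fin k))
  have he' : 2 ^ i % k = 2 ^ j % k := by simpa using he
  have h1 : (2 ^ i) • P = (2 ^ j) • P := by rw [← key, ← key (2 ^ j), he']
  obtain ⟨X1, Y1, g1, e1, l1⟩ := tw_iter n hn0 m P X Y h hP hL i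
  obtain ⟨X2, Y2, g2, e2, l2⟩ := tw_iter n hn0 m P X Y h hP hL j
  rw [e1, e2] at h1
  have hX : X1 = X2 := by
    injection h1
  rw [hX] at l1
  have := tw_uniq l1 l2
  omega

/-- For a nonzero squarefree integer `n`, the quadratic twist
`Eₙ : Y² = X³ + n²X + n³` of `E : Y² = X³ + X + 1` has trivial rational torsion:
any rational point killed by some positive integer is the point at infinity. -/
theorem twist_torsion_trivial (n : ℤ) (hn : Squarefree n) (hn0 : n ≠ 0)
    (P : WeierstrassCurve.Affine.Point
      (⟨0, 0, 0, (n : ℚ) ^ 2, (n : ℚ) ^ 3⟩ : WeierstrassCurve.Affine ℚ)) :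
    (∃ k : ℕ, 1 ≤ k ∧ k • P = 0) → P = 0 := by
  rintro ⟨k, hk, hkP⟩
  rcases hP : P with _ | ⟨X, Y, h⟩
  · rfl
  · exfalso
    have h2 : k • (2 • P) = 0 := tw_abs3 P k hkP
    have h4 : k • (2 • (2 • P)) = 0 := tw_abs3 _ k h2
    obtain ⟨X2, Y2, g2, e2, d2⟩ := tw_double n hn0 P X Y h hP
    obtain ⟨X4, Y4, g4, e4, d4⟩ := tw_double n hn0 _ X2 Y2 g2 e2
    rcases tw_cases (X / n) with hE | ⟨m, hL⟩
    · exact tw_no n hn0 1 _ X2 Y2 g2 e2 (by rw [d2]; exact (tw_E hE).2) k hk h2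
    · cases m with
      | zero =>
        have hE : TwE (X2 / n) := by rw [d2]; exact (tw_L0 hL).2
        exact tw_no n hn0 1 _ X4 Y4 g4 e4 (by rw [d4]; exact (tw_E hE).2) k hk h4
      | succ m => exact tw_no n hn0 m P X Y h hP hL k hk hkP
end

section
/- Let χ be a Dirichlet character modulo N (not necessarily primitive), let q be a prime dividing N, and let a be a nonzero integer with r = ν_q(a). Let q₁, …, q_t be the primes other than q dividing N. Suppose b and b′ are positive integers such that ν_q(b − a) ≥ r + ν_q(N) and ν_q(b′ − a) ≥ r + ν_q(N) (i.e. b ≡ b′ ≡ a (mod aN) q-adically), and ν_{q_i}(b − 1) ≥ ν_{q_i}(N) and ν_{q_i}(b′ − 1) ≥ ν_{q_i}(N) for each i = 1, …, t (i.e. b ≡ b′ ≡ 1 (mod N) q_i-adically). Then ν_q(b) = ν_q(b′) = r, the integers b/q^r and b′/q^r are coprime to N and congruent modulo N, and consequently χ(b/q^r) = χ(b′/q^r). In particular, writing b = q^r · ∏_j ℓ_j^{β_j} and b′ = q^r · ∏_j (ℓ′_j)^{β′_j} as products of prime powers with the ℓ_j and ℓ′_j prime and distinct from q, one has ∏_j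 χ(ℓ_j)^{−β_j} = ∏_j χ(ℓ′_j)^{−β′_j}. -/
lemma aux_prod {N : ℕ} (χ : DirichletCharacter ℂ N) (m : ℕ) (hm : m ≠ 0) :
    (m.factorization.prod fun ℓ β => χ ((ℓ : ℕ) : ZMod N) ^ (-(β : ℤ))) = (χ (m : ZMod N))⁻¹ := by
  conv_rhs => rw [← Nat.prod_factorization_pow_eq_self hm]
  simp only [Finsupp.prod, zpow_neg, zpow_natCast, Finset.prod_inv_distrib, Nat.cast_prod,
    Nat.cast_pow, map_prod, map_pow]

lemma aux_b (N : ℕ) (hN : 0 < N) (q : ℕ) (hq : q.Prime) (hqN : q ∣ N)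
    (c : ℤ) (hc : ¬ (q : ℤ) ∣ c) (r : ℕ) (b : ℕ) (hb : 0 < b)
    (hbq : (q : ℤ) ^ (r + padicValNat q N) ∣ (b : ℤ) - (q : ℤ) ^ r * c)
    (hbp : ∀ p : ℕ, p.Prime → p ∣ N → p ≠ q →
      (p : ℤ) ^ padicValNat p N ∣ (b : ℤ) - 1) :
    ∃ m : ℕ, b = q ^ r * m ∧ m ≠ 0 ∧ ¬ q ∣ m ∧ (q : ℤ) ^ padicValNat q N ∣ (m : ℤ) - c ∧
      Nat.Coprime m N := by
  have hq0 : (q : ℤ) ^ r ≠ 0 := pow_ne_zero _ (by exact_mod_cast hq.ne_zero)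
  have key : ∀ p : ℕ, p.Prime → p ∣ N → (p : ℤ) ∣ (p : ℤ) ^ padicValNat p N := by
    intro p hp hpN
    have := Fact.mk hp
    exact dvd_pow_self _ (by
      have := one_le_padicValNat_of_dvd hN.ne' hpN
      omega)
  have h1 : (q : ℤ) ^ r ∣ (b : ℤ) := by
    have h2 : (q : ℤ) ^ r ∣ (b : ℤ) - (q : ℤ) ^ r * c :=
      (pow_dvd_pow _ (Nat.le_add_right _ _)).trans hbq
    exact (dvd_sub_left (dvd_mul_right _ _)).1 h2
  have h1' : q ^ r ∣ b := by exact_mod_cast h1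
  obtain ⟨m, rfl⟩ := h1'
  have hm : (q : ℤ) ^ padicValNat q N ∣ (m : ℤ) - c := by
    rw [pow_add] at hbq
    push_cast at hbq
    rw [← mul_sub] at hbq
    exact (mul_dvd_mul_iff_left hq0).1 hbq
  have hqm : ¬ q ∣ m := by
    intro h
    have h' : (q : ℤ) ∣ m := by exact_mod_cast h
    exact hc ((dvd_sub_right h').1 ((key q hq hqN).trans hm))
  refine ⟨m, rfl, by rintro rfl; simp at hb, hqm, hm, ?_⟩
  apply Nat.Coprime.symm
  apply Nat.coprime_of_dvd
  intro p hp hpN hpm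
  by_cases hpq : p = q
  · subst hpq; exact hqm hpm
  · have h3 := (key p hp hpN).trans (hbp p hp hpN hpq)
    have h4 : (p : ℤ) ∣ ((q ^ r * m : ℕ) : ℤ) := by
      exact_mod_cast hpm.mul_left (q ^ r)
    have h5 : (p : ℤ) ∣ 1 := (dvd_sub_right h4).1 h3
    exact hp.one_lt.ne' (by exact_mod_cast Int.eq_one_of_dvd_one (by positivity) h5)


/-- Well-definedness of the recipe evaluating the local component `χ_q` of the Hecke character
attached to a Dirichlet character `χ` mod `N`.  Let `q` be a prime dividing `N`, `a ≠ 0` with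
`r = ν_q(a)`, and let `b, b'` be positive integers with `ν_q(b − a) ≥ r + ν_q(N)`,
`ν_q(b' − a) ≥ r + ν_q(N)`, and `ν_p(b − 1) ≥ ν_p(N)`, `ν_p(b' − 1) ≥ ν_p(N)` for every prime
`p ≠ q` dividing `N`.  Then `ν_q(b) = ν_q(b') = r`, the integers `b/q^r` and `b'/q^r` are
coprime to `N` and congruent mod `N`, hence `χ(b/q^r) = χ(b'/q^r)`; in particular, writing
`b = q^r ∏ ℓ_j^{β_j}` and `b' = q^r ∏ ℓ'_j^{β'_j}` with the `ℓ_j, ℓ'_j` prime and distinct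
from `q`, one has `∏ χ(ℓ_j)^{−β_j} = ∏ χ(ℓ'_j)^{−β'_j}`. -/
theorem heckeChar_local_value_well_defined (N : ℕ) (hN : 0 < N)
    (χ : DirichletCharacter ℂ N) (q : ℕ) (hq : q.Prime) (hqN : q ∣ N)
    (a : ℤ) (ha : a ≠ 0) (r : ℕ) (hr : r = padicValInt q a)
    (b b' : ℕ) (hb : 0 < b) (hb' : 0 < b')
    (hbq : (q : ℤ) ^ (r + padicValNat q N) ∣ (b : ℤ) - a)
    (hb'q : (q : ℤ) ^ (r + padicValNat q N) ∣ (b' : ℤ) - a)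
    (hbp : ∀ p : ℕ, p.Prime → p ∣ N → p ≠ q →
      (p : ℤ) ^ padicValNat p N ∣ (b : ℤ) - 1)
    (hb'p : ∀ p : ℕ, p.Prime → p ∣ N → p ≠ q →
      (p : ℤ) ^ padicValNat p N ∣ (b' : ℤ) - 1) :
    padicValNat q b = r ∧ padicValNat q b' = r ∧
      Nat.Coprime (b / q ^ r) N ∧ Nat.Coprime (b' / q ^ r) N ∧
      b / q ^ r ≡ b' / q ^ r [MOD N] ∧
      χ ((b / q ^ r : ℕ) : ZMod N) = χ ((b' / q ^ r : ℕ) : ZMod N) ∧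
      ((b / q ^ r).factorization.prod fun ℓ β => χ ((ℓ : ℕ) : ZMod N) ^ (-(β : ℤ))) =
        ((b' / q ^ r).factorization.prod fun ℓ β => χ ((ℓ : ℕ) : ZMod N) ^ (-(β : ℤ))) := by
  have := Fact.mk hq
  have hqr : 0 < q ^ r := pow_pos hq.pos r
  obtain ⟨c, hc⟩ : (q : ℤ) ^ r ∣ a := by rw [hr]; exact padicValInt_dvd a
  have hqc : ¬ (q : ℤ) ∣ c := by
    rintro ⟨d, rfl⟩
    have h : (q : ℤ) ^ (r + 1) ∣ a := ⟨d, by rw [hc]; ring⟩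
    rw [padicValInt_dvd_iff] at h
    rcases h with h | h
    · exact ha h
    · omega
  rw [hc] at hbq hb'q
  obtain ⟨m, rfl, hm0, hqm, hmc, hmN⟩ := aux_b N hN q hq hqN c hqc r b hb hbq hbp
  obtain ⟨m', rfl, hm0', hqm', hmc', hmN'⟩ := aux_b N hN q hq hqN c hqc r b' hb' hb'q hb'p
  have hval : ∀ k : ℕ, k ≠ 0 → ¬ q ∣ k → padicValNat q (q ^ r * k) = r := by
    intro k hk hqk
    rw [padicValNat.mul hqr.ne' hk, padicValNat.prime_pow, padicValNat.eq_zero_of_not_dvd hqk,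
      add_zero]
  rw [Nat.mul_div_cancel_left _ hqr, Nat.mul_div_cancel_left _ hqr]
  have hmod : m ≡ m' [MOD N] := by
    rw [Nat.modEq_iff_dvd, Int.natCast_dvd, Nat.dvd_iff_prime_pow_dvd_dvd]
    intro p k hp hpk
    rcases Nat.eq_zero_or_pos k with rfl | hk
    · simp
    have hpN : p ∣ N := (dvd_pow_self p hk.ne').trans hpk
    have := Fact.mk hp
    have hle : k ≤ padicValNat p N := (padicValNat_dvd_iff_le hN.ne').1 hpk
    refine (pow_dvd_pow p hle).trans ?_
    rw [← Int.natCast_dvd]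
    push_cast
    by_cases hpq : p = q
    · subst hpq
      have := dvd_sub hmc' hmc
      simpa using this
    · have h := dvd_sub (hb'p p hp hpN hpq) (hbp p hp hpN hpq)
      push_cast at h
      have h2 : (p : ℤ) ^ padicValNat p N ∣ (q : ℤ) ^ r * ((m' : ℤ) - m) := by
        have e : (q : ℤ) ^ r * ((m' : ℤ) - m) = (q ^ r * m' - 1) - (q ^ r * m - 1) := by ring
        rw [e]
        exact h
      refine IsCoprime.dvd_of_dvd_mul_left ?_ h2
      exact (Nat.isCoprime_iff_coprime.2 ((Nat.coprime_primes hp hq).2 hpq)).pow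
  have hχ : χ (m : ZMod N) = χ (m' : ZMod N) := by
    rw [(ZMod.natCast_eq_natCast_iff m m' N).2 hmod]
  exact ⟨hval m hm0 hqm, hval m' hm0' hqm', hmN, hmN', hmod, hχ,
    by rw [aux_prod χ m hm0, aux_prod χ m' hm0', hχ]⟩
end
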